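/- Inpainting error estimate (Lipschitz case): Let Λ ⊂ ℝ^n be convex and compact, Ω ⊂ Λ a nonempty open set, and K = Λ ∖ Ω. Let f : Λ → ℝ be bounded and uniformly continuous, and let f̃ : ℝ^n → ℝ be a globally Lipschitz extension of f with Lipschitz constant L > 0, with |f̃(x)| ≤ A_0 for all x ∈ ℝ^n, and f̃ = c_0 (a constant) outside the open ball B(0, r), where r > 0 and K ⊂ B(0, r). For R > r set K_R = K ∪ (ℝ^n ∖ B(0, R)). Then for every λ > 0, every M > A_0 + λ(R + r)², and every x ∈ co[K]: |A^M_λ(f̃_{K_R})(x) − f̃(x)| ≤ L r_c(x) + L²/λ, where r_c(x) is the convex density radius of x with respect to K. -/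

import Mathlib

open Metric Set

variable {E : Type*}

/-- Convex envelope of `g`: the pointwise supremum of all affine functions lying below `g`. -/
noncomputable def convEnv [NormedAddCommGroup E] [NormedSpace ℝ E]
    (g : E → ℝ) (x : E) : ℝ :=
  sSup {v : ℝ | ∃ l : E →ᵃ[ℝ] ℝ, (∀ y, l y ≤ g y) ∧ v = l x}

/-- Lower compensated convex transform `C^l_λ(f)`. -/
noncomputable def lowerTransform [NormedAddCommGroup E] [NormedSpace ℝ E]
    (lam : ℝ) (f : E → ℝ) (x : E) : ℝ :=
  convEnv (fun y => lam * ‖y‖ ^ 2 + f y) x - lam * ‖x‖ ^ 2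

/-- Upper compensated convex transform `C^u_λ(f)`. -/
noncomputable def upperTransform [NormedAddCommGroup E] [NormedSpace ℝ E]
    (lam : ℝ) (f : E → ℝ) (x : E) : ℝ :=
  lam * ‖x‖ ^ 2 - convEnv (fun y => lam * ‖y‖ ^ 2 - f y) x

open Classical in
/-- `extendBy f K M` is the function equal to `f` on `K` and to the constant `M` off `K`. -/
noncomputable def extendBy (f : E → ℝ) (K : Set E) (M : ℝ) (x : E) : ℝ :=
  if x ∈ K then f x else M

/-- Average compensated convex approximation `A^M_λ(f_K)`. -/
noncomputable def avgApprox [NormedAddCommGroup E] [NormedSpace ℝ E]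
    (lam M : ℝ) (f : E → ℝ) (K : Set E) (x : E) : ℝ :=
  (lowerTransform lam (extendBy f K M) x + upperTransform lam (extendBy f K (-M)) x) / 2

/-- Convex density radius `r_c(x)` of a point `x` with respect to a set `K`. -/
noncomputable def convexDensityRadius [NormedAddCommGroup E] [NormedSpace ℝ E]
    (K : Set E) (x : E) : ℝ :=
  sInf {r : ℝ | 0 ≤ r ∧ x ∈ convexHull ℝ (Metric.closedBall x r ∩ K)}

/-- If every affine function below `G` on `S` has value at most `Q` at `x ∈ co S`, then `(x, Q)` lies
in the closed convex hull of the epigraph of `G` over `S`. -/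
theorem mem_closure_convexHull_epigraph [NormedAddCommGroup E] [NormedSpace ℝ E]
    {G : E → ℝ} {S : Set E} {x : E} {Q : ℝ} (hx : x ∈ convexHull ℝ S)
    (hQ : ∀ l : E →ᵃ[ℝ] ℝ, (∀ y ∈ S, l y ≤ G y) → l x ≤ Q) :
    (x, Q) ∈ closure (convexHull ℝ {p : E × ℝ | p.1 ∈ S ∧ G p.1 ≤ p.2}) := by
  set C := convexHull ℝ {p : E × ℝ | p.1 ∈ S ∧ G p.1 ≤ p.2}
  by_contra hmem
  obtain ⟨F, u, hFx, hFC⟩ := geometric_hahn_banach_point_closed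
    ((convex_convexHull ℝ _).closure : Convex ℝ (closure C)) isClosed_closure hmem
  set α : ℝ := F (0, 1)
  have hsplit : ∀ y t, F (y, t) = F (y, 0) + t * α := by
    intro y t
    have : ((y, t) : E × ℝ) = (y, 0) + t • (0, 1) := by simp
    rw [this, map_add, map_smul, smul_eq_mul]
  have hep : ∀ y ∈ S, ∀ t, G y ≤ t → u < F (y, 0) + t * α := by
    intro y hy t ht
    rw [← hsplit]
    exact hFC _ (subset_closure (subset_convexHull ℝ _ ⟨hy, ht⟩))
  rw [hsplit] at hFx
  obtain ⟨y₀, hy₀⟩ : S.Nonempty := convexHull_nonempty_iff.1 ⟨x, hx⟩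
  have hα0 : 0 ≤ α := by
    by_contra! hneg
    have h := hep y₀ hy₀ (max (G y₀) ((u - F (y₀, 0)) / α)) (le_max_left _ _)
    have h2 := mul_le_mul_of_nonpos_right (le_max_right (G y₀) ((u - F (y₀, 0)) / α)) hneg.le
    rw [div_mul_cancel₀ _ hneg.ne] at h2
    linarith
  have hpos : 0 < α := by
    rcases hα0.lt_or_eq with h | h
    · exact h
    · exfalso
      have hconv : Convex ℝ {y : E | u < (F.comp (ContinuousLinearMap.inl ℝ E ℝ)) y} :=
        convex_halfSpace_gt (LinearMap.isLinear
          (F.comp (ContinuousLinearMap.inl ℝ E ℝ)).toLinearMap) u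
      have hsub : S ⊆ {y : E | u < (F.comp (ContinuousLinearMap.inl ℝ E ℝ)) y} := by
        intro y hy
        have := hep y hy _ le_rfl
        rw [← h] at this
        simpa using this
      have h3 := convexHull_min hsub hconv hx
      have h4 : u < F (x, 0) := by simpa using h3
      rw [← h] at hFx
      linarith
  let l : E →ᵃ[ℝ] ℝ := AffineMap.const ℝ E (u / α) -
    (α⁻¹ • (F.comp (ContinuousLinearMap.inl ℝ E ℝ)).toLinearMap).toAffineMap
  have hl : ∀ y, l y = (u - F (y, 0)) / α := by
    intro y
    simp [l]
    ring
  have h5 := hQ l fun y hy => by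
    rw [hl, div_le_iff₀ hpos]
    linarith [hep y hy _ le_rfl]
  rw [hl, div_le_iff₀ hpos] at h5
  linarith

/-- An affine function bounded on a sphere by a constant is bounded by it on the ball. -/
theorem AffineMap.le_of_le_on_sphere [NormedAddCommGroup E] [NormedSpace ℝ E] [Nontrivial E]
    (l : E →ᵃ[ℝ] ℝ) {R c : ℝ} (hR : 0 ≤ R) (h : ∀ a : E, ‖a‖ = R → l a ≤ c)
    {y : E} (hy : ‖y‖ ≤ R) : l y ≤ c := by
  have hconv : Convex ℝ {a : E | l a ≤ c} := (convex_Iic c).affine_preimage l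
  have hsub : sphere (0 : E) R ⊆ {a : E | l a ≤ c} := fun a ha => h a (by simpa using ha)
  refine convexHull_min hsub hconv ?_
  rw [convexHull_sphere_eq_closedBall 0 hR]
  simpa using hy

/-- An affine function below `lam * ‖·‖ ^ 2 + g` on a set containing the complement of a ball is
below the extended function everywhere, provided the module `M` is large enough. -/
theorem le_extendBy_of_le_on [NormedAddCommGroup E] [NormedSpace ℝ E] [Nontrivial E]
    {g : E → ℝ} {S : Set E} {A R lam M : ℝ} (hR : 0 ≤ R) (hlam : 0 ≤ lam)
    (hg : ∀ y, g y ≤ A) (hS : (ball 0 R)ᶜ ⊆ S) (hM : A + lam * R ^ 2 ≤ M)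
    (l : E →ᵃ[ℝ] ℝ) (hl : ∀ y ∈ S, l y ≤ lam * ‖y‖ ^ 2 + g y) (y : E) :
    l y ≤ lam * ‖y‖ ^ 2 + extendBy g S M y := by
  unfold extendBy
  split_ifs with hy
  · exact hl y hy
  · have hyR : ‖y‖ < R := by
      by_contra! h
      exact hy (hS (by simpa using h))
    have h1 : l y ≤ lam * R ^ 2 + A := by
      refine l.le_of_le_on_sphere hR (fun a ha => ?_) hyR.le
      have := hl a (hS (by simp [ha]))
      rw [ha] at this
      linarith [hg a]
    nlinarith [mul_nonneg hlam (sq_nonneg ‖y‖)]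

theorem upperTransform_eq_neg_lowerTransform [NormedAddCommGroup E] [NormedSpace ℝ E]
    (lam : ℝ) (f : E → ℝ) (x : E) :
    upperTransform lam f x = -lowerTransform lam (-f) x := by
  simp [upperTransform, lowerTransform, sub_eq_add_neg, add_comm]

theorem neg_extendBy (f : E → ℝ) (S : Set E) (M : ℝ) :
    -extendBy f S (-M) = extendBy (-f) S M := by
  funext y
  by_cases h : y ∈ S <;> simp [extendBy, h]

/-- Comparison of the convex envelopes with data `f` and `-f` on `S`. -/
theorem convEnv_sub_convEnv_neg_le [NormedAddCommGroup E] [InnerProductSpace ℝ E]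
    [FiniteDimensional ℝ E] [Nontrivial E]
    {f : E → ℝ} {S : Set E} {A R lam M L ρ : ℝ} (hR : 0 ≤ R) (hlam : 0 < lam) (hL : 0 < L)
    (hf : ∀ y, |f y| ≤ A) (hlip : ∀ x y, |f x - f y| ≤ L * dist x y)
    (hS : (ball 0 R)ᶜ ⊆ S) (hM : A + lam * R ^ 2 ≤ M) {x : E}
    (hρ : 0 ≤ ρ) (hx : x ∈ convexHull ℝ (closedBall x ρ ∩ S)) :
    convEnv (fun y => lam * ‖y‖ ^ 2 + extendBy f S M y) x -
      convEnv (fun y => lam * ‖y‖ ^ 2 + extendBy (-f) S M y) x ≤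
      2 * f x + 2 * (L * ρ + L ^ 2 / lam) := by
  have hAM : A ≤ M := by nlinarith [mul_nonneg hlam.le (sq_nonneg R)]
  have hA : 0 ≤ A := (abs_nonneg _).trans (hf x)
  have hnorm : ∀ y, ‖y‖ ^ 2 = ‖y - x‖ ^ 2 + 2 * inner ℝ x y - ‖x‖ ^ 2 := by
    intro y
    rw [norm_sub_sq_real, real_inner_comm]
    ring
  have hfx : ∀ y, |f y - f x| ≤ L * ‖y - x‖ := fun y => by
    simpa [dist_eq_norm] using hlip y x
  have hext : ∀ y ∈ S, ∀ g : E → ℝ, extendBy g S M y = g y := fun y hy g => by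
    simp [extendBy, hy]
  set Q := convEnv (fun y => lam * ‖y‖ ^ 2 + extendBy (-f) S M y) x
  -- upper bound for minorants of the second function
  have hup : ∀ l : E →ᵃ[ℝ] ℝ, (∀ y ∈ S, l y ≤ lam * ‖y‖ ^ 2 + (-f) y) →
      l x ≤ lam * ‖x‖ ^ 2 + lam * ρ ^ 2 + L * ρ - f x := by
    intro l hl
    let m : E →ᵃ[ℝ] ℝ := l - ((2 * lam) • (innerSL ℝ x).toLinearMap).toAffineMap
    have hm : ∀ y, m y = l y - 2 * lam * inner ℝ x y := fun y => by simp [m]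
    have hconv : Convex ℝ {y : E | m y ≤ lam * ρ ^ 2 + L * ρ - f x - lam * ‖x‖ ^ 2} :=
      (convex_Iic _).affine_preimage m
    have h := convexHull_min (fun y hy => ?_) hconv hx
    · simp only [mem_ofPred_eq, hm, real_inner_self_eq_norm_sq] at h
      linarith
    · simp only [mem_ofPred_eq, hm]
      have h1 := hl y hy.2
      rw [hnorm y, Pi.neg_apply] at h1
      have h2 : ‖y - x‖ ≤ ρ := by simpa [dist_eq_norm] using hy.1
      have h3 := (abs_le.1 (hfx y)).1
      have h4 : ‖y - x‖ ^ 2 ≤ ρ ^ 2 := by gcongr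
      nlinarith [mul_le_mul_of_nonneg_left h4 hlam.le, mul_le_mul_of_nonneg_left h2 hL.le]
  have hres : ∀ g : E → ℝ, ∀ l : E →ᵃ[ℝ] ℝ,
      (∀ y, l y ≤ lam * ‖y‖ ^ 2 + extendBy g S M y) → ∀ y ∈ S, l y ≤ lam * ‖y‖ ^ 2 + g y := by
    intro g l hl y hy
    simpa only [hext y hy] using hl y
  have hconst : ∀ g : E → ℝ, (∀ y, -A ≤ g y) →
      ∀ y, AffineMap.const ℝ E (-A) y ≤ lam * ‖y‖ ^ 2 + extendBy g S M y := by
    intro g hg y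
    have : -A ≤ extendBy g S M y := by
      unfold extendBy
      split_ifs
      · exact hg y
      · linarith
    have := mul_nonneg hlam.le (sq_nonneg ‖y‖)
    simp only [AffineMap.const_apply]
    linarith
  have hQup : Q ≤ lam * ‖x‖ ^ 2 + lam * ρ ^ 2 + L * ρ - f x := by
    refine csSup_le ⟨_, _, hconst (-f) fun y => neg_le_neg (abs_le.1 (hf y)).2, rfl⟩ ?_
    rintro _ ⟨l, hl, rfl⟩
    exact hup l (hres _ l hl)
  have hQle : ∀ l : E →ᵃ[ℝ] ℝ, (∀ y ∈ S, l y ≤ lam * ‖y‖ ^ 2 + (-f) y) → l x ≤ Q := by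
    intro l hl
    refine le_csSup ⟨lam * ‖x‖ ^ 2 + lam * ρ ^ 2 + L * ρ - f x, ?_⟩ ⟨l, ?_, rfl⟩
    · rintro _ ⟨l', hl', rfl⟩
      exact hup l' (hres _ l' hl')
    · exact le_extendBy_of_le_on hR hlam.le
        (fun y => by simpa using neg_le.1 (abs_le.1 (hf y)).1) hS hM l hl
  have hcl := mem_closure_convexHull_epigraph (convexHull_mono inter_subset_right hx) hQle
  -- it suffices to bound each minorant of the first function
  suffices hmain : ∀ l : E →ᵃ[ℝ] ℝ, (∀ y ∈ S, l y ≤ lam * ‖y‖ ^ 2 + f y) →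
      l x ≤ Q + 2 * f x + 2 * (L * ρ + L ^ 2 / lam) by
    have : convEnv (fun y => lam * ‖y‖ ^ 2 + extendBy f S M y) x ≤
        Q + 2 * f x + 2 * (L * ρ + L ^ 2 / lam) := by
      refine csSup_le ⟨_, _, hconst f fun y => (abs_le.1 (hf y)).1, rfl⟩ ?_
      rintro _ ⟨l, hl, rfl⟩
      exact hmain l (hres _ l hl)
    linarith
  intro l hl
  -- `s` plays the role of the mean distance to `x` of the points of a convex combination
  let T : Set (E × ℝ) := {p | ∃ s : ℝ,
    lam * s ^ 2 - L * s - f x ≤ p.2 - 2 * lam * inner ℝ x p.1 + lam * ‖x‖ ^ 2 ∧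
    l p.1 ≤ p.2 + 2 * f x + 2 * L * s}
  have hTconv : Convex ℝ T := by
    rintro ⟨z, w⟩ ⟨s, h1, h2⟩ ⟨z', w'⟩ ⟨s', h1', h2'⟩ a b ha hb hab
    refine ⟨a * s + b * s', ?_, ?_⟩
    · simp only [Prod.smul_mk, Prod.mk_add_mk, smul_eq_mul, inner_add_right,
        real_inner_smul_right] at h1 h1' ⊢
      have hsq : (a * s + b * s') ^ 2 ≤ a * s ^ 2 + b * s' ^ 2 := by
        obtain rfl : b = 1 - a := by linarith
        nlinarith [mul_nonneg (mul_nonneg ha hb) (sq_nonneg (s - s'))]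
      have e1 := mul_le_mul_of_nonneg_left h1 ha
      have e2 := mul_le_mul_of_nonneg_left h1' hb
      have e3 := mul_le_mul_of_nonneg_left hsq hlam.le
      have e4 : a * f x + b * f x = f x := by rw [← add_mul, hab, one_mul]
      have e5 : a * (lam * ‖x‖ ^ 2) + b * (lam * ‖x‖ ^ 2) = lam * ‖x‖ ^ 2 := by
        rw [← add_mul, hab, one_mul]
      linarith
    · have hlin : l (a • z + b • z') = a * l z + b * l z' := by
        simpa using Convex.combo_affine_apply (f := l) (x := z) (y := z') hab
      simp only [Prod.smul_mk, Prod.mk_add_mk, smul_eq_mul] at h2 h2' ⊢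
      rw [hlin]
      have e1 := mul_le_mul_of_nonneg_left h2 ha
      have e2 := mul_le_mul_of_nonneg_left h2' hb
      have e4 : a * f x + b * f x = f x := by rw [← add_mul, hab, one_mul]
      linarith
  have hepiT : {p : E × ℝ | p.1 ∈ S ∧ lam * ‖p.1‖ ^ 2 + (-f) p.1 ≤ p.2} ⊆ T := by
    rintro ⟨y, t⟩ ⟨hy, ht⟩
    have h1 := abs_le.1 (hfx y)
    have h2 := hl y hy
    simp only [Pi.neg_apply] at ht hy
    refine ⟨‖y - x‖, ?_, ?_⟩ <;> dsimp only
    · rw [hnorm y] at ht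
      linarith [h1.2]
    · linarith [h1.2]
  let D : E × ℝ → ℝ := fun p =>
    (p.2 - 2 * lam * inner ℝ x p.1 + lam * ‖x‖ ^ 2 + f x) / lam + (L / (2 * lam)) ^ 2
  let U : Set (E × ℝ) := {p | l p.1 ≤ p.2 + 2 * f x + 2 * L * (L / (2 * lam) + √(D p))}
  have hTU : T ⊆ U := by
    rintro ⟨z, w⟩ ⟨s, h1, h2⟩
    have h3 : (s - L / (2 * lam)) ^ 2 ≤ D (z, w) := by
      have : lam * (s - L / (2 * lam)) ^ 2 ≤ lam * D (z, w) := by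
        have e1 : lam * (s - L / (2 * lam)) ^ 2 =
            lam * s ^ 2 - L * s + lam * (L / (2 * lam)) ^ 2 := by
          field_simp
          ring
        have e2 : lam * D (z, w) =
            w - 2 * lam * inner ℝ x z + lam * ‖x‖ ^ 2 + f x + lam * (L / (2 * lam)) ^ 2 := by
          simp only [D]
          field_simp
        rw [e1, e2]
        dsimp only at h1
        linarith
      exact le_of_mul_le_mul_left this hlam
    have h4 := Real.le_sqrt_of_sq_le h3
    have h5 : L * s ≤ L * (L / (2 * lam) + √(D (z, w))) := by
      gcongr
      linarith
    simp only [U, mem_ofPred_eq]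
    dsimp only at h2
    linarith
  have hlc : Continuous l := l.continuous_of_finiteDimensional
  have hUcl : IsClosed U := by
    have hD : Continuous D := by
      simp only [D]
      fun_prop
    refine isClosed_le ?_ ?_ <;> fun_prop
  have hU : (x, Q) ∈ U :=
    closure_minimal ((convexHull_min hepiT hTconv).trans hTU) hUcl hcl
  have hDle : D (x, Q) ≤ (ρ + L / (2 * lam)) ^ 2 := by
    have e : (ρ + L / (2 * lam)) ^ 2 = (lam * ρ ^ 2 + L * ρ) / lam + (L / (2 * lam)) ^ 2 := by
      field_simp
      ring
    rw [e]
    simp only [D, real_inner_self_eq_norm_sq]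
    refine add_le_add ((div_le_div_iff_of_pos_right hlam).2 ?_) le_rfl
    linarith
  have hsqrt : √(D (x, Q)) ≤ ρ + L / (2 * lam) :=
    (Real.sqrt_le_left (by positivity)).2 hDle
  have h6 : L * (L / (2 * lam) + √(D (x, Q))) ≤ L * ρ + L ^ 2 / lam := by
    calc L * (L / (2 * lam) + √(D (x, Q))) ≤ L * (L / (2 * lam) + (ρ + L / (2 * lam))) := by gcongr
      _ = L * ρ + L ^ 2 / lam := by field_simp; ring
  simp only [U, mem_ofPred_eq] at hU
  linarith

/-- **Inpainting error estimate (Lipschitz case).** -/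
theorem inpainting_error_estimate_lipschitz {n : ℕ}
    (Λ : Set (EuclideanSpace ℝ (Fin n))) (hΛconv : Convex ℝ Λ) (hΛcpt : IsCompact Λ)
    (Ω : Set (EuclideanSpace ℝ (Fin n))) (hΩsub : Ω ⊆ Λ) (hΩne : Ω.Nonempty)
    (hΩopen : IsOpen Ω)
    (K : Set (EuclideanSpace ℝ (Fin n))) (hK : K = Λ \ Ω)
    (f : EuclideanSpace ℝ (Fin n) → ℝ)
    (hfbd : ∃ C : ℝ, ∀ x ∈ Λ, |f x| ≤ C) (hfuc : UniformContinuousOn f Λ)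
    (ftil : EuclideanSpace ℝ (Fin n) → ℝ)
    (hext : ∀ x ∈ Λ, ftil x = f x)
    (L : ℝ) (hL : 0 < L)
    (hlip : ∀ x y : EuclideanSpace ℝ (Fin n), |ftil x - ftil y| ≤ L * dist x y)
    (A0 : ℝ) (hA0 : ∀ x, |ftil x| ≤ A0)
    (c0 r : ℝ) (hr : 0 < r)
    (hc0 : ∀ x : EuclideanSpace ℝ (Fin n), r ≤ ‖x‖ → ftil x = c0)
    (hKr : K ⊆ Metric.ball 0 r)
    (R : ℝ) (hR : r < R)
    (lam M : ℝ) (hlam : 0 < lam) (hM : A0 + lam * (R + r) ^ 2 < M) :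
    ∀ x ∈ convexHull ℝ K,
      |avgApprox lam M ftil (K ∪ (Metric.ball 0 R)ᶜ) x - ftil x| ≤
        L * convexDensityRadius K x + L ^ 2 / lam := by
  intro x hx
  have hKne : K.Nonempty := convexHull_nonempty_iff.1 ⟨x, hx⟩
  have hnt : Nontrivial (EuclideanSpace ℝ (Fin n)) := by
    obtain ⟨a, ha⟩ := hKne
    obtain ⟨b, hb⟩ := hΩne
    rw [hK] at ha
    exact ⟨a, b, fun h => ha.2 (h ▸ hb)⟩
  have hM' : A0 + lam * R ^ 2 ≤ M := by
    have : R ^ 2 ≤ (R + r) ^ 2 := by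
      have := hr.trans hR
      gcongr
      linarith
    linarith [mul_le_mul_of_nonneg_left this hlam.le]
  have hR0 : 0 ≤ R := (hr.trans hR).le
  have hxr : x ∈ ball (0 : EuclideanSpace ℝ (Fin n)) r := convexHull_min hKr (convex_ball 0 r) hx
  have hne : {ρ : ℝ | 0 ≤ ρ ∧ x ∈ convexHull ℝ (closedBall x ρ ∩ K)}.Nonempty := by
    refine ⟨2 * r, by positivity, ?_⟩
    rwa [inter_eq_self_of_subset_right]
    intro y hy
    have h1 : dist y 0 < r := hKr hy
    have h2 : dist x 0 < r := hxr
    rw [mem_closedBall]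
    linarith [dist_triangle_right y x 0]
  set S := K ∪ (ball (0 : EuclideanSpace ℝ (Fin n)) R)ᶜ
  have hbound : ∀ ρ ∈ {ρ : ℝ | 0 ≤ ρ ∧ x ∈ convexHull ℝ (closedBall x ρ ∩ K)},
      |avgApprox lam M ftil S x - ftil x| ≤ L * ρ + L ^ 2 / lam := by
    rintro ρ ⟨hρ, hxρ⟩
    have hxS : x ∈ convexHull ℝ (closedBall x ρ ∩ S) :=
      convexHull_mono (inter_subset_inter_right _ subset_union_left) hxρ
    have h1 := convEnv_sub_convEnv_neg_le hR0 hlam hL hA0 hlip subset_union_right hM' hρ hxS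
    have h2 := convEnv_sub_convEnv_neg_le (f := -ftil) hR0 hlam hL
      (fun y => by simpa using hA0 y)
      (fun y z => by
        simpa only [Pi.neg_apply, neg_sub_neg, abs_sub_comm] using hlip y z) subset_union_right hM' hρ hxS
    rw [neg_neg, Pi.neg_apply] at h2
    rw [avgApprox, upperTransform_eq_neg_lowerTransform, neg_extendBy, lowerTransform,
      lowerTransform, abs_le]
    constructor <;> linarith
  have hinf : (|avgApprox lam M ftil S x - ftil x| - L ^ 2 / lam) / L ≤
      convexDensityRadius K x := by
    refine le_csInf hne fun ρ hρ => ?_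
    rw [div_le_iff₀ hL]
    linarith [hbound ρ hρ]
  rw [div_le_iff₀ hL] at hinf
  linarith
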